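/- arXiv:2108.02884 — 3 statements merged into one kernel-verified Lean document; each statement's English description precedes it below -/
import Mathlib

section
/- Let G be a group, R a commutative ring with unit, and a, b, c ∈ G. Then in the skein algebra S(G;R) one has [abc] = [a]·[bc] + [b]·[ac] + [c]·[ab] − [a]·[b]·[c] − [acb]. -/
open MvPolynomial

noncomputable section

/-- The skein ideal of a group `G` over a commutative ring `R`: generated by
`X e - 2` and `X g * X h - X (g*h) - X (g*h⁻¹)`. -/
def skeinIdeal (R G : Type*) [CommRing R] [Group G] : Ideal (MvPolynomial G R) :=
  Ideal.span ({X (1 : G) - 2} ∪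
    {p | ∃ g h : G, p = X g * X h - X (g * h) - X (g * h⁻¹)})

/-- The skein algebra `S(G;R)`. -/
abbrev SkeinAlgebra (R G : Type*) [CommRing R] [Group G] :=
  MvPolynomial G R ⧸ skeinIdeal R G

/-- `[g]`, the class of the variable `X g` in the skein algebra. -/
def cl (R : Type*) {G : Type*} [CommRing R] [Group G] (g : G) : SkeinAlgebra R G :=
  Ideal.Quotient.mk (skeinIdeal R G) (X g)

theorem cl_one (R G : Type*) [CommRing R] [Group G] : cl R (1 : G) = 2 := by
  have h : Ideal.Quotient.mk (skeinIdeal R G) (X (1 : G) - 2) = 0 :=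
    Ideal.Quotient.eq_zero_iff_mem.mpr (Ideal.subset_span (Or.inl rfl))
  rw [map_sub, map_ofNat] at h
  exact sub_eq_zero.mp h

theorem cl_mul_cl (R : Type*) {G : Type*} [CommRing R] [Group G] (g h : G) :
    cl R g * cl R h = cl R (g * h) + cl R (g * h⁻¹) := by
  have hgh : Ideal.Quotient.mk (skeinIdeal R G)
      (X g * X h - X (g * h) - X (g * h⁻¹)) = 0 :=
    Ideal.Quotient.eq_zero_iff_mem.mpr (Ideal.subset_span (Or.inr ⟨g, h, rfl⟩))
  rw [map_sub, map_sub, map_mul] at hgh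
  unfold cl
  linear_combination hgh

theorem cl_inv (R : Type*) {G : Type*} [CommRing R] [Group G] (g : G) :
    cl R g⁻¹ = cl R g := by
  have h := cl_mul_cl R 1 g
  rw [cl_one, one_mul, one_mul] at h
  linear_combination -h

theorem cl_mul_comm (R : Type*) {G : Type*} [CommRing R] [Group G] (g h : G) :
    cl R (g * h) = cl R (h * g) := by
  have hgh := cl_mul_cl R g h
  have hhg := cl_mul_cl R h g
  have hinv := cl_inv R (g * h⁻¹)
  rw [mul_inv_rev, inv_inv] at hinv
  linear_combination hhg - hgh + hinv

theorem skein_class_abc (R G : Type*) [CommRing R] [Group G] (a b c : G) :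
    cl R (a * b * c) =
      cl R a * cl R (b * c) + cl R b * cl R (a * c) + cl R c * cl R (a * b)
        - cl R a * cl R b * cl R c - cl R (a * c * b) := by
  have h₁ := cl_mul_cl R a (b * c)
  have h₂ := cl_mul_cl R (a * c) b
  have h₃ := cl_mul_cl R a b
  have h₄ := cl_mul_cl R (b⁻¹ * a) c
  rw [cl_mul_comm R b⁻¹ a, mul_assoc b⁻¹ a c, mul_assoc b⁻¹ a c⁻¹,
    cl_mul_comm R b⁻¹ (a * c), cl_mul_comm R b⁻¹ (a * c⁻¹)] at h₄
  rw [mul_inv_rev, ← mul_assoc, ← mul_assoc] at h₁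
  linear_combination -h₁ - h₂ + cl R c * h₃ + h₄
end
end

section
/- Let G be a group generated by three elements g₁, g₂, g₃ and let ι : F₃ → G be the group homomorphism with ι(gᵢ) = gᵢ for i = 1,2,3. Then S(G;ℂ) is isomorphic as a ℂ-algebra to the quotient of S(F₃;ℂ) by the ideal generated by all elements [u] − [v] with u, v ∈ F₃ such that ι(u) = ι(v). -/
open MvPolynomial

noncomputable section

/-- The free group on three generators. -/
abbrev F3 := FreeGroup (Fin 3)

def g1 : F3 := FreeGroup.of 0
def g2 : F3 := FreeGroup.of 1
def g3 : F3 := FreeGroup.of 2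

/-- The words `g₁, g₂, g₃, g₁g₂, g₁g₃, g₂g₃, g₁g₂g₃` indexed by the seven variables
`x₁, x₂, x₃, x₁₂, x₁₃, x₂₃, x₁₂₃`. -/
def word : Fin 7 → F3 := ![g1, g2, g3, g1 * g2, g1 * g3, g2 * g3, g1 * g2 * g3]

/-- `Φ : ℂ[x₁,…,x₁₂₃] → S(F₃;ℂ)`, `x_{i₁⋯i_k} ↦ [g_{i₁}⋯g_{i_k}]`. -/
def Phi : MvPolynomial (Fin 7) ℂ →ₐ[ℂ] SkeinAlgebra ℂ F3 :=
  aeval fun i => cl ℂ (word i)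

-- the seven variables
def x1 : MvPolynomial (Fin 7) ℂ := X 0
def x2 : MvPolynomial (Fin 7) ℂ := X 1
def x3 : MvPolynomial (Fin 7) ℂ := X 2
def x12 : MvPolynomial (Fin 7) ℂ := X 3
def x13 : MvPolynomial (Fin 7) ℂ := X 4
def x23 : MvPolynomial (Fin 7) ℂ := X 5
def x123 : MvPolynomial (Fin 7) ℂ := X 6

/-- The polynomial `K`. -/
def K : MvPolynomial (Fin 7) ℂ :=
  x123 ^ 2 - (x12 * x3 + x13 * x2 + x23 * x1 - x1 * x2 * x3) * x123
    + x1 ^ 2 + x2 ^ 2 + x3 ^ 2 + x12 ^ 2 + x23 ^ 2 + x13 ^ 2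
    - x1 * x2 * x12 - x1 * x3 * x13 - x2 * x3 * x23 + x12 * x13 * x23 - 4

namespace SkeinAlgebra

variable {R G H A : Type*} [CommRing R] [Group G] [Group H] [CommRing A] [Algebra R A]

theorem cl_one : cl R (1 : G) = 2 := by
  have h : Ideal.Quotient.mk (skeinIdeal R G) (X 1 - 2) = 0 :=
    Ideal.Quotient.eq_zero_iff_mem.2 (Ideal.subset_span (Or.inl rfl))
  rwa [map_sub, map_ofNat, sub_eq_zero] at h

theorem cl_mul_cl (g h : G) : cl R g * cl R h = cl R (g * h) + cl R (g * h⁻¹) := by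
  have hmem : Ideal.Quotient.mk (skeinIdeal R G) (X g * X h - X (g * h) - X (g * h⁻¹)) = 0 :=
    Ideal.Quotient.eq_zero_iff_mem.2 (Ideal.subset_span (Or.inr ⟨g, h, rfl⟩))
  rwa [map_sub, map_sub, map_mul, sub_sub, sub_eq_zero] at hmem

/-- The universal property of the skein algebra: a function satisfying the trace relations extends
to an algebra homomorphism. -/
def lift (f : G → A) (one : f 1 = 2) (mul : ∀ g h, f g * f h = f (g * h) + f (g * h⁻¹)) :
    SkeinAlgebra R G →ₐ[R] A :=
  Ideal.Quotient.liftₐ (skeinIdeal R G) (aeval f) fun p hp => by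
    have hle : skeinIdeal R G ≤ RingHom.ker (aeval (R := R) f) := by
      refine Ideal.span_le.2 ?_
      rintro _ (rfl | ⟨g, h, rfl⟩) <;> simp [RingHom.mem_ker, one, mul]
    exact hle hp

@[simp]
theorem lift_cl (f : G → A) (one : f 1 = 2)
    (mul : ∀ g h, f g * f h = f (g * h) + f (g * h⁻¹)) (g : G) :
    lift (R := R) f one mul (cl R g) = f g :=
  aeval_X f g

theorem hom_ext {φ ψ : SkeinAlgebra R G →ₐ[R] A} (h : ∀ g, φ (cl R g) = ψ (cl R g)) : φ = ψ :=
  Ideal.Quotient.algHom_ext R (MvPolynomial.algHom_ext h)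

/-- The map of skein algebras induced by a group homomorphism. -/
def map (f : H →* G) : SkeinAlgebra R H →ₐ[R] SkeinAlgebra R G :=
  lift (fun h => cl R (f h)) (by rw [map_one, cl_one]) fun g h => by
    rw [cl_mul_cl, map_mul, map_mul, map_inv]

@[simp]
theorem map_cl (f : H →* G) (h : H) : map f (cl R h) = cl R (f h) :=
  lift_cl _ _ _ h

variable (R) in
/-- The ideal generated by the differences of classes of elements identified by a group
homomorphism. -/
abbrev kerIdeal (f : H →* G) : Ideal (SkeinAlgebra R H) :=
  Ideal.span {p | ∃ u v : H, f u = f v ∧ p = cl R u - cl R v}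

theorem kerIdeal_le_ker_map (f : H →* G) :
    kerIdeal R f ≤ RingHom.ker (map (R := R) f) := by
  refine Ideal.span_le.2 ?_
  rintro _ ⟨u, v, huv, rfl⟩
  simp [RingHom.mem_ker, huv]

theorem mk_kerIdeal_cl_eq (f : H →* G) {u v : H} (huv : f u = f v) :
    Ideal.Quotient.mkₐ R (kerIdeal R f) (cl R u) = Ideal.Quotient.mkₐ R (kerIdeal R f) (cl R v) :=
  Ideal.Quotient.eq.2 (Ideal.subset_span ⟨u, v, huv, rfl⟩)

/-- The map from the skein algebra of the target of a surjective homomorphism, sending a class to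
the class of any preimage. -/
def toQuotientKerIdeal (f : H →* G) (hf : Function.Surjective f) :
    SkeinAlgebra R G →ₐ[R] SkeinAlgebra R H ⧸ kerIdeal R f :=
  lift (fun g => Ideal.Quotient.mkₐ R (kerIdeal R f) (cl R (Function.surjInv hf g)))
    (by
      rw [mk_kerIdeal_cl_eq f (v := 1) (by rw [Function.surjInv_eq hf, map_one]), cl_one, map_ofNat])
    fun g h => by
      rw [← map_mul, cl_mul_cl, map_add]
      congr 1 <;> exact mk_kerIdeal_cl_eq f (by simp [Function.surjInv_eq hf])

theorem toQuotientKerIdeal_cl (f : H →* G) (hf : Function.Surjective f) (h : H) :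
    toQuotientKerIdeal f hf (cl R (f h)) = Ideal.Quotient.mkₐ R (kerIdeal R f) (cl R h) :=
  (lift_cl _ _ _ _).trans (mk_kerIdeal_cl_eq f (Function.surjInv_eq hf _))

/-- For a surjective homomorphism `f : H →* G`, the skein algebra of `G` is the quotient of that of
`H` by `kerIdeal R f`. -/
def equivQuotientKerIdeal (f : H →* G) (hf : Function.Surjective f) :
    SkeinAlgebra R G ≃ₐ[R] SkeinAlgebra R H ⧸ kerIdeal R f :=
  AlgEquiv.ofAlgHom (toQuotientKerIdeal f hf)
    (Ideal.Quotient.liftₐ (kerIdeal R f) (map f) fun _ hp => kerIdeal_le_ker_map f hp)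
    (by
      refine Ideal.Quotient.algHom_ext R ?_
      refine hom_ext (A := SkeinAlgebra R H ⧸ kerIdeal R f) fun h => ?_
      exact (congrArg _ (map_cl f h)).trans (toQuotientKerIdeal_cl f hf h))
    (by
      refine hom_ext fun g => ?_
      obtain ⟨h, rfl⟩ := hf g
      exact (congrArg _ (toQuotientKerIdeal_cl f hf h)).trans (map_cl f h))

end SkeinAlgebra

/-- Lemma 2.1: if `G` is generated by `g 0, g 1, g 2` and `ι : F₃ → G` sends the
free generators to them, then `S(G;ℂ)` is isomorphic to the quotient of `S(F₃;ℂ)`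
by the ideal generated by all `[u] - [v]` with `ι u = ι v`. -/
theorem skein_of_three_generated (G : Type*) [Group G] (g : Fin 3 → G)
    (hg : Subgroup.closure (Set.range g) = ⊤) :
    Nonempty (SkeinAlgebra ℂ G ≃ₐ[ℂ]
      (SkeinAlgebra ℂ F3 ⧸ Ideal.span
        {p : SkeinAlgebra ℂ F3 | ∃ u v : F3,
          FreeGroup.lift g u = FreeGroup.lift g v ∧ p = cl ℂ u - cl ℂ v})) := by
  refine ⟨SkeinAlgebra.equivQuotientKerIdeal (FreeGroup.lift g) ?_⟩
  exact FreeGroup.lift_surjective_iff_closure_range_eq_top.2 hg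
end
end

section
/- Let G be the group presented by generators g₁, g₂, g₃ and relations α = β and γ = δ, where α = g₃g₂⁻¹g₁g₂g₁⁻¹, β = g₂⁻¹g₁g₂g₁⁻¹g₃, γ = g₂g₁⁻¹g₃g₁g₃⁻¹, δ = g₁⁻¹g₃g₁g₃⁻¹g₂ (this is the fundamental group of the Borromean rings complement in S³). Then S(G;ℂ) is isomorphic as a ℂ-algebra to ℂ[x₁, x₂, x₃, x₁₂, x₁₃, x₂₃, x₁₂₃]/I, where I is the ideal generated by the following fourteen polynomials: K = x₁₂₃² − (x₁x₂₃ + x₂x₁₃ + x₃x₁₂ − x₁x₂x₃)x₁₂₃ + x₁² + x₂² + x₃² + x₁₂² + x₁₃² + x₂₃² − x₁x₂x₁₂ − x₁x₃x₁₃ − x₂x₃x₂₃ + x₁₂x₁₃x₂₃ − 4; −2x₁₂x₂₃ + 2x₂x₁₂₃ − x₁²x₂x₁₂₃ + x₁x₂x₁₂x₁₃ + x₁x₂x₂₃ + x₁x₁₂x₁₂₃ − x₁₂²x₁₃ − x₂²x₁₃; 2x₁₃x₂₃ − 2x₃x₁₂₃ + x₁²x₃x₁₂₃ − x₁x₃x₁₂x₁₃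 − x₁x₃x₂₃ − x₁x₁₃x₁₂₃ + x₁₂x₁₃² + x₃²x₁₂; −x₁x₂x₁₂x₂₃ + x₁₂²x₂₃ + x₁²x₂₃ + x₁x₂²x₁₂₃ − x₂x₁₂x₁₂₃ − 2x₁x₁₂₃ − x₁x₂x₁₃ + 2x₁₂x₁₃; x₁x₃x₁₃x₂₃ − x₁₃²x₂₃ − x₁²x₂₃ − x₁x₃²x₁₂₃ + x₃x₁₃x₁₂₃ + 2x₁x₁₂₃ + x₁x₃x₁₂ − 2x₁₂x₁₃; −x₁²x₁₂₃ + x₂²x₁₂₃ + x₁x₁₂x₁₃ − x₂x₁₂x₂₃ − 2x₂x₁₃ + 2x₁x₂₃; x₁³ + x₁x₃² + x₁x₁₃² − x₁²x₃x₁₃ − 4x₁ + x₁²x₂x₃x₁₂₃ − x₁x₂x₁₃x₁₂₃ − x₁x₂x₃x₂₃ − x₁x₃x₁₂x₁₂₃ + x₁₂x₁₃x₁₂₃ − x₁²x₂x₁₂ + x₁x₁₂² + x₃x₁₂x₂₃ − x₂x₃x₁₂₃ + x₂x₁₃x₂₃ + x₁x₂²; −4x₁ + x₁³ + x₁x₁₂²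 + x₁₂x₁₃x₁₂₃ + x₁x₁₃² − x₁²x₂x₁₂ − x₁x₂x₁₃x₁₂₃ + x₁x₂² + x₂x₁₃x₂₃ − x₁²x₃x₁₃ − x₃x₁₂²x₁₃ + x₂x₃x₁₂₃ + x₁x₂x₃x₁₂x₁₃ − x₂²x₃x₁₃ − x₃x₁₂x₂₃ + x₁x₃²; x₁²x₁₂₃ − x₃²x₁₂₃ − x₁³x₂₃ + x₃³x₁₂ − x₁x₁₂x₁₃ + x₃x₁₃x₂₃ + 2x₁x₂₃ − 2x₃x₁₂ − x₁x₁₃²x₂₃ + x₃x₁₂x₁₃² + x₁²x₃x₁₂ − x₁x₃²x₂₃ + x₁²x₃x₁₃x₂₃ − x₁x₃²x₁₂x₁₃; x₂³ + x₂x₃² + x₂x₂₃² − x₂²x₃x₂₃ − 4x₂ + x₁x₂²x₃x₁₂₃ − x₁x₂x₂₃x₁₂₃ − x₁x₂x₃x₁₃ − x₂x₃x₁₂x₁₂₃ + x₁₂x₂₃x₁₂₃ − x₁x₂²x₁₂ + x₂x₁₂² + x₃x₁₂x₁₃ − x₁x₃x₁₂₃ + x₁x₁₃x₂₃ + x₁²x₂;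 −x₃³ − x₁²x₃ − x₃x₁₃² + x₁x₃²x₁₃ + 4x₃ − x₁x₂x₃²x₁₂₃ + x₂x₃x₁₃x₁₂₃ + x₁x₂x₃x₁₂ + x₁x₃x₂₃x₁₂₃ − x₁₃x₂₃x₁₂₃ + x₂x₃²x₂₃ − x₃x₂₃² − x₁x₁₂x₂₃ + x₁x₂x₁₂₃ − x₂x₁₂x₁₃ − x₂²x₃; −x₂x₃x₁₂x₂₃ + x₃²x₁₂ + x₁x₃x₂₃ − x₂x₃x₁₃ − 4x₁₂ + x₂²x₁₂ + x₁₂³ + x₁²x₁₂ − x₁x₂x₁₂² − x₁x₂x₁₂₃² + x₁₂x₁₂₃² + x₁x₂x₃x₁₂x₁₂₃ − x₃x₁₂²x₁₂₃ + x₂x₂₃x₁₂₃ − x₁²x₃x₁₂₃ + x₁x₁₃x₁₂₃; (−x₁x₂₃ + x₃x₁₂)x₁₃x₁₂₃ + (x₁x₁₂ − x₃x₂₃)x₁₂₃ + (x₃² − x₁²)x₁₂x₂₃ + (x₂₃² − x₁₂²)x₁₃ + (x₁²x₃x₂₃ − x₁x₃²x₁₂)x₁₂₃ + (x₁₂² −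 x₂₃²)x₁x₃ + (x₁x₂₃ − x₃x₁₂)x₂. -/
open MvPolynomial

noncomputable section

-- the relators of the fundamental group of the Borromean rings complement
def ralpha : F3 := g3 * g2⁻¹ * g1 * g2 * g1⁻¹
def rbeta : F3 := g2⁻¹ * g1 * g2 * g1⁻¹ * g3
def rgamma : F3 := g2 * g1⁻¹ * g3 * g1 * g3⁻¹
def rdelta : F3 := g1⁻¹ * g3 * g1 * g3⁻¹ * g2

/-- The fundamental group of the Borromean rings complement, presented as
`⟨g₁,g₂,g₃ | α = β, γ = δ⟩`. -/
abbrev BorromeanGroup :=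
  F3 ⧸ Subgroup.normalClosure {ralpha * rbeta⁻¹, rgamma * rdelta⁻¹}

def Q_a1 : MvPolynomial (Fin 7) ℂ :=
  -2*x12*x23 + 2*x2*x123 - x1^2*x2*x123 + x1*x2*x12*x13 + x1*x2*x23
    + x1*x12*x123 - x12^2*x13 - x2^2*x13

def Q_c1 : MvPolynomial (Fin 7) ℂ :=
  2*x13*x23 - 2*x3*x123 + x1^2*x3*x123 - x1*x3*x12*x13 - x1*x3*x23
    - x1*x13*x123 + x12*x13^2 + x3^2*x12

def Q_a2 : MvPolynomial (Fin 7) ℂ :=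
  -(x1*x2*x12*x23) + x12^2*x23 + x1^2*x23 + x1*x2^2*x123 - x2*x12*x123
    - 2*x1*x123 - x1*x2*x13 + 2*x12*x13

def Q_c3 : MvPolynomial (Fin 7) ℂ :=
  x1*x3*x13*x23 - x13^2*x23 - x1^2*x23 - x1*x3^2*x123 + x3*x13*x123
    + 2*x1*x123 + x1*x3*x12 - 2*x12*x13

def Q_a12 : MvPolynomial (Fin 7) ℂ :=
  -(x1^2*x123) + x2^2*x123 + x1*x12*x13 - x2*x12*x23 - 2*x2*x13 + 2*x1*x23

def Q_c12 : MvPolynomial (Fin 7) ℂ :=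
  x1^3 + x1*x3^2 + x1*x13^2 - x1^2*x3*x13 - 4*x1 + x1^2*x2*x3*x123
    - x1*x2*x13*x123 - x1*x2*x3*x23 - x1*x3*x12*x123 + x12*x13*x123
    - x1^2*x2*x12 + x1*x12^2 + x3*x12*x23 - x2*x3*x123 + x2*x13*x23 + x1*x2^2

def Q_a13 : MvPolynomial (Fin 7) ℂ :=
  -4*x1 + x1^3 + x1*x12^2 + x12*x13*x123 + x1*x13^2 - x1^2*x2*x12
    - x1*x2*x13*x123 + x1*x2^2 + x2*x13*x23 - x1^2*x3*x13 - x3*x12^2*x13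
    + x2*x3*x123 + x1*x2*x3*x12*x13 - x2^2*x3*x13 - x3*x12*x23 + x1*x3^2

def Q_c13 : MvPolynomial (Fin 7) ℂ :=
  x1^2*x123 - x3^2*x123 - x1^3*x23 + x3^3*x12 - x1*x12*x13 + x3*x13*x23
    + 2*x1*x23 - 2*x3*x12 - x1*x13^2*x23 + x3*x12*x13^2 + x1^2*x3*x12
    - x1*x3^2*x23 + x1^2*x3*x13*x23 - x1*x3^2*x12*x13

def Q_a23 : MvPolynomial (Fin 7) ℂ :=
  x2^3 + x2*x3^2 + x2*x23^2 - x2^2*x3*x23 - 4*x2 + x1*x2^2*x3*x123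
    - x1*x2*x23*x123 - x1*x2*x3*x13 - x2*x3*x12*x123 + x12*x23*x123
    - x1*x2^2*x12 + x2*x12^2 + x3*x12*x13 - x1*x3*x123 + x1*x13*x23 + x1^2*x2

def Q_c23 : MvPolynomial (Fin 7) ℂ :=
  -(x3^3) - x1^2*x3 - x3*x13^2 + x1*x3^2*x13 + 4*x3 - x1*x2*x3^2*x123
    + x2*x3*x13*x123 + x1*x2*x3*x12 + x1*x3*x23*x123 - x13*x23*x123
    + x2*x3^2*x23 - x3*x23^2 - x1*x12*x23 + x1*x2*x123 - x2*x12*x13 - x2^2*x3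

def Q_a123 : MvPolynomial (Fin 7) ℂ :=
  -(x2*x3*x12*x23) + x3^2*x12 + x1*x3*x23 - x2*x3*x13 - 4*x12 + x2^2*x12
    + x12^3 + x1^2*x12 - x1*x2*x12^2 - x1*x2*x123^2 + x12*x123^2
    + x1*x2*x3*x12*x123 - x3*x12^2*x123 + x2*x23*x123 - x1^2*x3*x123
    + x1*x13*x123

def Q_c123 : MvPolynomial (Fin 7) ℂ :=
  (-(x1*x23) + x3*x12)*x13*x123 + (x1*x12 - x3*x23)*x123
    + (x3^2 - x1^2)*x12*x23 + (x23^2 - x12^2)*x13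
    + (x1^2*x3*x23 - x1*x3^2*x12)*x123 + (x12^2 - x23^2)*x1*x3
    + (x1*x23 - x3*x12)*x2

/-- The ideal of Theorem 3, generated by the fourteen explicit polynomials. -/
def IBorromean : Ideal (MvPolynomial (Fin 7) ℂ) :=
  Ideal.span {K, Q_a1, Q_c1, Q_a2, Q_c3, Q_a12, Q_c12, Q_a13, Q_c13,
    Q_a23, Q_c23, Q_a123, Q_c123}

section Trace

variable {G S : Type*} [Group G] [CommRing S]

/-- A function satisfying the defining relations of the skein algebra. -/
structure IsSkeinTrace (t : G → S) : Prop where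
  one : t 1 = 2
  mul : ∀ g h, t g * t h = t (g * h) + t (g * h⁻¹)

namespace IsSkeinTrace

variable {t : G → S}

theorem inv (ht : IsSkeinTrace t) (g : G) : t g⁻¹ = t g := by
  have h := ht.mul 1 g
  rw [ht.one, one_mul, one_mul] at h
  linear_combination -h

theorem mul_comm (ht : IsSkeinTrace t) (g h : G) : t (g * h) = t (h * g) := by
  have h₁ := ht.mul g h
  have h₂ := ht.mul h g
  have h₃ := ht.inv (g * h⁻¹)
  rw [mul_inv_rev, inv_inv] at h₃
  linear_combination h₂ - h₁ + h₃

end IsSkeinTrace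

/-- The `S`-module of functions on `G` that are skein-linear with respect to `t` in every
position of a word. -/
def skeinFun (t : G → S) : Submodule S (G → S) where
  carrier := {f | ∀ g w h, f (g * w * h) + f (g * w⁻¹ * h) = t w * f (g * h)}
  add_mem' {f₁ f₂} h₁ h₂ g w h := by
    simp only [Pi.add_apply]
    linear_combination h₁ g w h + h₂ g w h
  zero_mem' g w h := by simp
  smul_mem' c f hf g w h := by
    simp only [Pi.smul_apply, smul_eq_mul]
    linear_combination c * hf g w h

theorem IsSkeinTrace.mem_skeinFun {t : G → S} (ht : IsSkeinTrace t) : t ∈ skeinFun t := by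
  intro g w h
  rw [ht.mul_comm (g * w) h, ht.mul_comm (g * w⁻¹) h, ht.mul_comm g h, ← mul_assoc, ← mul_assoc,
    ← ht.mul, _root_.mul_comm]

theorem comp_mul_left_mem_skeinFun {t f : G → S} (hf : f ∈ skeinFun t) (k : G) :
    (fun g => f (k * g)) ∈ skeinFun t := by
  intro g w h
  simpa only [mul_assoc] using hf (k * g) w h

/-- Right translation on skein-linear functions. -/
def skeinTranslate (t : G → S) : G →* Module.End S (skeinFun t) where
  toFun k :=
    { toFun := fun f => ⟨fun g => f.1 (g * k), fun g w h => by
        simpa only [mul_assoc] using f.2 g w (h * k)⟩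
      map_add' := fun _ _ => rfl
      map_smul' := fun _ _ => rfl }
  map_one' := by ext; simp
  map_mul' k l := by ext; simp [mul_assoc]

variable {t : G → S}

theorem skeinTranslate_apply (k : G) (f : skeinFun t) (g : G) :
    (skeinTranslate t k f).1 g = f.1 (g * k) := rfl

theorem skeinTranslate_inv (w : G) (f : skeinFun t) :
    skeinTranslate t w⁻¹ f = t w • f - skeinTranslate t w f := by
  ext g
  have h := f.2 g w 1
  simp only [mul_one] at h
  change f.1 (g * w⁻¹) = t w * f.1 g - f.1 (g * w)
  linear_combination h

theorem skeinTranslate_self (w : G) (f : skeinFun t) :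
    skeinTranslate t w (skeinTranslate t w f) = t w • skeinTranslate t w f - f := by
  ext g
  have h := f.2 g w w
  rw [inv_mul_cancel_right] at h
  change f.1 (g * w * w) = t w * f.1 (g * w) - f.1 g
  linear_combination h

theorem skeinTranslate_swap (v w : G) (f : skeinFun t) :
    skeinTranslate t w (skeinTranslate t v f) = (t (v * w) - t v * t w) • f
      + t w • skeinTranslate t v f + t v • skeinTranslate t w f
      - skeinTranslate t v (skeinTranslate t w f) := by
  ext g
  have h₁ := f.2 g (v * w) 1
  have h₂ := f.2 (g * w⁻¹) v 1
  have h₃ := f.2 g w 1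
  have h₄ := f.2 g w v
  simp only [mul_one, mul_inv_rev, ← mul_assoc] at h₁ h₂ h₃ h₄
  change f.1 (g * w * v) = (t (v * w) - t v * t w) * f.1 g + t w * f.1 (g * v) + t v * f.1 (g * w)
    - f.1 (g * v * w)
  linear_combination h₁ - h₂ - t v * h₃ + h₄

end Trace

section FreeGroupThree

variable {S : Type*} [CommRing S] {t : F3 → S}

theorem skeinTranslate_g2_g1 (f : skeinFun t) :
    skeinTranslate t g2 (skeinTranslate t g1 f) = (t (g1 * g2) - t g1 * t g2) • f
      + t g2 • skeinTranslate t g1 f + t g1 • skeinTranslate t g2 f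
      - skeinTranslate t g1 (skeinTranslate t g2 f) :=
  skeinTranslate_swap g1 g2 f

theorem skeinTranslate_g3_g1 (f : skeinFun t) :
    skeinTranslate t g3 (skeinTranslate t g1 f) = (t (g1 * g3) - t g1 * t g3) • f
      + t g3 • skeinTranslate t g1 f + t g1 • skeinTranslate t g3 f
      - skeinTranslate t g1 (skeinTranslate t g3 f) :=
  skeinTranslate_swap g1 g3 f

theorem skeinTranslate_g3_g2 (f : skeinFun t) :
    skeinTranslate t g3 (skeinTranslate t g2 f) = (t (g2 * g3) - t g2 * t g3) • f
      + t g3 • skeinTranslate t g2 f + t g2 • skeinTranslate t g3 f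
      - skeinTranslate t g2 (skeinTranslate t g3 f) :=
  skeinTranslate_swap g2 g3 f

theorem IsSkeinTrace.eq_skeinTranslate (ht : IsSkeinTrace t) (g : F3) :
    t g = (skeinTranslate t g ⟨t, ht.mem_skeinFun⟩).1 1 := by
  simp [skeinTranslate_apply]

theorem IsSkeinTrace.sq_g1_g2_g3 (ht : IsSkeinTrace t) :
    t (g1 * g2 * g3) ^ 2 - (t (g1 * g2) * t g3 + t (g1 * g3) * t g2 + t (g2 * g3) * t g1
      - t g1 * t g2 * t g3) * t (g1 * g2 * g3) + t g1 ^ 2 + t g2 ^ 2 + t g3 ^ 2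
      + t (g1 * g2) ^ 2 + t (g2 * g3) ^ 2 + t (g1 * g3) ^ 2 - t g1 * t g2 * t (g1 * g2)
      - t g1 * t g3 * t (g1 * g3) - t g2 * t g3 * t (g2 * g3)
      + t (g1 * g2) * t (g1 * g3) * t (g2 * g3) - 4 = 0 := by
  have h₁ := ht.mul (g1 * g2 * g3) (g1 * g2 * g3)
  rw [mul_inv_cancel, ht.one] at h₁
  have h₂ := ht.eq_skeinTranslate (g1 * g2 * g3 * (g1 * g2 * g3))
  simp only [map_mul, Module.End.mul_apply, skeinTranslate_g2_g1, skeinTranslate_g3_g1,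
    skeinTranslate_g3_g2, skeinTranslate_self, map_add, map_sub, map_smul] at h₂
  simp only [Submodule.coe_add, Submodule.coe_sub, Submodule.coe_smul, Pi.add_apply, Pi.sub_apply,
    Pi.smul_apply, smul_eq_mul, skeinTranslate_apply, one_mul, ht.one] at h₂
  linear_combination h₁ + h₂

end FreeGroupThree

section SkeinAlgebra

theorem isSkeinTrace_cl (R G : Type*) [CommRing R] [Group G] :
    IsSkeinTrace (cl R : G → SkeinAlgebra R G) where
  one := by
    rw [cl, ← map_ofNat (Ideal.Quotient.mk (skeinIdeal R G)) 2, Ideal.Quotient.eq]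
    exact Ideal.subset_span (Or.inl rfl)
  mul g h := by
    rw [← sub_eq_zero, ← sub_sub, cl, cl, cl, cl, ← map_mul, ← map_sub, ← map_sub,
      Ideal.Quotient.eq_zero_iff_mem]
    exact Ideal.subset_span (Or.inr ⟨g, h, rfl⟩)

/-- The universal property of the skein algebra. -/
def skeinLift (R : Type*) {G A : Type*} [CommRing R] [Group G] [CommRing A] [Algebra R A]
    {t : G → A} (ht : IsSkeinTrace t) : SkeinAlgebra R G →ₐ[R] A :=
  Ideal.Quotient.liftₐ (skeinIdeal R G) (aeval t) fun p hp => by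
    suffices skeinIdeal R G ≤ RingHom.ker (aeval t : MvPolynomial G R →ₐ[R] A) from this hp
    refine Ideal.span_le.mpr ?_
    rintro p (rfl | ⟨g, h, rfl⟩)
    · simp [ht.one]
    · simp [ht.mul]

theorem skeinLift_cl {R G A : Type*} [CommRing R] [Group G] [CommRing A] [Algebra R A]
    {t : G → A} (ht : IsSkeinTrace t) (g : G) : skeinLift R ht (cl R g) = t g := by
  change aeval t (X g) = t g
  simp

theorem surjective_of_cl_mem_range {R G A : Type*} [CommRing R] [Group G] [CommRing A]
    [Algebra R A] (φ : A →ₐ[R] SkeinAlgebra R G) (hφ : ∀ g, cl R g ∈ φ.range) :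
    Function.Surjective φ := by
  intro s
  obtain ⟨p, rfl⟩ := Ideal.Quotient.mk_surjective s
  change _ ∈ φ.range
  induction p using MvPolynomial.induction_on with
  | C a => exact φ.range.algebraMap_mem a
  | add p q hp hq => rw [map_add]; exact add_mem hp hq
  | mul_X p g hp => rw [map_mul]; exact mul_mem hp (hφ g)

end SkeinAlgebra

section Representations

open Matrix

theorem isSkeinTrace_trace {G R : Type*} [Group G] [CommRing R]
    (ρ : G →* SpecialLinearGroup (Fin 2) R) : IsSkeinTrace fun g => (ρ g).1.trace where
  one := by simp
  mul g h := by
    rw [map_mul, map_mul, map_inv]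
    change _ = ((ρ g).1 * (ρ h).1).trace + ((ρ g).1 * adjugate (ρ h).1).trace
    simp only [adjugate_fin_two, trace_fin_two, mul_apply, Fin.sum_univ_two, of_apply, cons_val',
      cons_val_zero, cons_val_one, cons_val_fin_one]
    ring

/-- The values of the seven coordinates at a triple of matrices. -/
def traceCoords (a b c : SpecialLinearGroup (Fin 2) ℂ) : Fin 7 → ℂ :=
  ![a.1.trace, b.1.trace, c.1.trace, (a.1 * b.1).trace, (a.1 * c.1).trace, (b.1 * c.1).trace,
    (a.1 * b.1 * c.1).trace]

theorem eval_traceCoords_eq_zero {p : MvPolynomial (Fin 7) ℂ} (hp : Phi p = 0)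
    (a b c : SpecialLinearGroup (Fin 2) ℂ) : eval (traceCoords a b c) p = 0 := by
  let χ := skeinLift ℂ (isSkeinTrace_trace (FreeGroup.lift ![a, b, c]))
  have h : χ.comp Phi = aeval (traceCoords a b c) := by
    ext i
    fin_cases i <;> simp [χ, Phi, word, traceCoords, g1, g2, g3, skeinLift_cl]
  rw [← coe_aeval_eq_eval]
  change aeval (traceCoords a b c) p = 0
  rw [← h, AlgHom.comp_apply, hp, map_zero]

/-- A triple of matrices with prescribed trace coordinates exists away from the locus where
the first two matrices have a common eigenvector. -/
theorem exists_traceCoords_eq {x₁ x₂ x₃ x₁₂ x₁₃ x₂₃ z : ℂ}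
    (hz : z ^ 2 - (x₁₂ * x₃ + x₁₃ * x₂ + x₂₃ * x₁ - x₁ * x₂ * x₃) * z + x₁ ^ 2 + x₂ ^ 2 + x₃ ^ 2
      + x₁₂ ^ 2 + x₂₃ ^ 2 + x₁₃ ^ 2 - x₁ * x₂ * x₁₂ - x₁ * x₃ * x₁₃ - x₂ * x₃ * x₂₃
      + x₁₂ * x₁₃ * x₂₃ - 4 = 0)
    (hκ : x₁ ^ 2 + x₂ ^ 2 + x₁₂ ^ 2 - x₁ * x₂ * x₁₂ - 4 ≠ 0) (hx : x₁₂ ^ 2 - 4 ≠ 0) :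
    ∃ a b c, traceCoords a b c = ![x₁, x₂, x₃, x₁₂, x₁₃, x₂₃, z] := by
  obtain ⟨w, hw⟩ := IsAlgClosed.exists_pow_nat_eq (x₁₂ ^ 2 - 4) two_pos
  obtain ⟨q, q', hq, rfl⟩ : ∃ q q' : ℂ, q * q' = 1 ∧ x₁₂ = q + q' :=
    ⟨(x₁₂ + w) / 2, (x₁₂ - w) / 2, by linear_combination -hw / 4, by ring⟩
  have hd : q - q' ≠ 0 := by
    intro h
    apply hx
    linear_combination (q - q') * h + 4 * hq
  obtain ⟨p, hp⟩ : ∃ p, (x₁ ^ 2 + x₂ ^ 2 + (q + q') ^ 2 - x₁ * x₂ * (q + q') - 4) * p =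
      (q - q') * q * x₃ + (x₁ * q - x₂) * (x₂₃ - x₂ * x₃ + q' * x₁₃) - (q - q') * z :=
    ⟨_, mul_div_cancel₀ _ hκ⟩
  obtain ⟨s, hs⟩ : ∃ s, (q - q') * s = x₂₃ - x₂ * (x₃ - p) + q' * (x₁₃ - x₁ * p) :=
    ⟨_, mul_div_cancel₀ _ hd⟩
  obtain ⟨r, rfl⟩ : ∃ r, x₁₃ = x₁ * p - s + r := ⟨x₁₃ - x₁ * p + s, by ring⟩
  obtain rfl : x₂₃ = q * s - q' * r + x₂ * (x₃ - p) := by linear_combination -hs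
  obtain rfl : z = p * q' + (x₁ * q - x₂) * s + q * (x₃ - p) := by
    apply mul_left_cancel₀ hd
    linear_combination hp + (x₁ ^ 2 - 4) * p * hq
  have hc : p * (x₃ - p) - r * s = 1 := by
    apply mul_left_cancel₀ hκ
    linear_combination -hz + (-2 * x₁ * p * r + 2 * x₁ * p * s + x₁ * x₃ * r - x₁ * x₃ * s + x₁ ^ 2 * r * s
      + 4 * p * x₃ - 4 * p ^ 2 - x₃ ^ 2 - 2 * r * s - r ^ 2 - s ^ 2) * hq
  refine ⟨⟨!![x₁, -1; 1, 0], by simp [det_fin_two]⟩, ⟨!![0, q; -q', x₂], by simp [det_fin_two, hq]⟩,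
    ⟨!![p, r; s, x₃ - p], by rw [det_fin_two]; simpa using hc⟩, ?_⟩
  ext i
  fin_cases i <;> simp [traceCoords, trace_fin_two] <;> try ring

end Representations

section Kernel

/-- Minus the linear coefficient of `K` as a polynomial in `x₁₂₃`. -/
def coeffK : MvPolynomial (Fin 6) ℂ :=
  X 3 * X 2 + X 4 * X 1 + X 5 * X 0 - X 0 * X 1 * X 2

/-- The constant coefficient of `K` as a polynomial in `x₁₂₃`. -/
def constK : MvPolynomial (Fin 6) ℂ :=
  X 0 ^ 2 + X 1 ^ 2 + X 2 ^ 2 + X 3 ^ 2 + X 5 ^ 2 + X 4 ^ 2 - X 0 * X 1 * X 3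
    - X 0 * X 2 * X 4 - X 1 * X 2 * X 5 + X 3 * X 4 * X 5 - 4

theorem K_eq : K = X 6 ^ 2 - rename Fin.castSucc coeffK * X 6 + rename Fin.castSucc constK := by
  simp only [K, coeffK, constK, x1, x2, x3, x12, x13, x23, x123, map_add, map_sub, map_mul, map_pow,
    rename_X, map_ofNat]
  change _ = X 6 ^ 2 - (X 3 * X 2 + X 4 * X 1 + X 5 * X 0 - X 0 * X 1 * X 2) * X 6 +
    (X 0 ^ 2 + X 1 ^ 2 + X 2 ^ 2 + X 3 ^ 2 + X 5 ^ 2 + X 4 ^ 2 - X 0 * X 1 * X 3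
    - X 0 * X 2 * X 4 - X 1 * X 2 * X 5 + X 3 * X 4 * X 5 - 4)
  ring

theorem exists_eq_linear_add_mul_K (p : MvPolynomial (Fin 7) ℂ) :
    ∃ (u v : MvPolynomial (Fin 6) ℂ) (r : MvPolynomial (Fin 7) ℂ),
      p = rename Fin.castSucc u + rename Fin.castSucc v * X 6 + K * r := by
  induction p using MvPolynomial.induction_on with
  | C a => exact ⟨C a, 0, 0, by simp⟩
  | add p q hp hq =>
    obtain ⟨u, v, r, rfl⟩ := hp
    obtain ⟨u', v', r', rfl⟩ := hq
    exact ⟨u + u', v + v', r + r', by simp only [map_add]; ring⟩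
  | mul_X p i hp =>
    obtain ⟨u, v, r, rfl⟩ := hp
    induction i using Fin.lastCases with
    | cast j =>
      refine ⟨u * X j, v * X j, r * X j.castSucc, ?_⟩
      simp only [map_mul, rename_X]
      ring
    | last =>
      refine ⟨-(v * constK), u + v * coeffK, r * X 6 + rename Fin.castSucc v, ?_⟩
      change _ * X 6 = _
      simp only [map_neg, map_add, map_mul, K_eq]
      ring

theorem eval_castSucc (y : Fin 6 → ℂ) (z : ℂ) (u : MvPolynomial (Fin 6) ℂ) :
    eval (Fin.snoc (α := fun _ => ℂ) y z : Fin 7 → ℂ) (rename Fin.castSucc u) = eval y u := by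
  rw [eval_rename]
  congr 2
  ext i
  simp

theorem eval_snoc_K (y : Fin 6 → ℂ) (z : ℂ) :
    eval (Fin.snoc (α := fun _ => ℂ) y z : Fin 7 → ℂ) K =
      z ^ 2 - eval y coeffK * z + eval y constK := by
  have h : (Fin.snoc (α := fun _ => ℂ) y z : Fin 7 → ℂ) 6 = z :=
    Fin.snoc_last (α := fun _ => ℂ) z y
  simp only [K_eq, map_add, map_sub, map_mul, map_pow, eval_castSucc, eval_X, h]

/-- The locus of coordinates where `exists_traceCoords_eq` fails or where `K` has a double root
in `x₁₂₃`. -/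
def degenerate : MvPolynomial (Fin 6) ℂ :=
  (X 0 ^ 2 + X 1 ^ 2 + X 3 ^ 2 - X 0 * X 1 * X 3 - 4) * (X 3 ^ 2 - 4) * (coeffK ^ 2 - 4 * constK)

theorem degenerate_ne_zero : degenerate ≠ 0 := by
  intro h
  have := congrArg (eval 0) h
  simp only [degenerate, coeffK, constK, map_add, map_sub, map_mul, map_pow, map_ofNat, map_zero,
    eval_X, Pi.zero_apply] at this
  norm_num at this

theorem exists_traceCoords_eq_snoc {y : Fin 6 → ℂ} (hy : eval y degenerate ≠ 0) {z : ℂ}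
    (hz : z ^ 2 - eval y coeffK * z + eval y constK = 0) :
    ∃ a b c, traceCoords a b c = Fin.snoc (α := fun _ => ℂ) y z := by
  rw [degenerate, map_mul, map_mul] at hy
  have h₁ := left_ne_zero_of_mul (left_ne_zero_of_mul hy)
  have h₂ := right_ne_zero_of_mul (left_ne_zero_of_mul hy)
  simp only [coeffK, constK, map_add, map_sub, map_mul, map_pow, map_ofNat, eval_X] at hz h₁ h₂
  obtain ⟨a, b, c, h⟩ := exists_traceCoords_eq (x₃ := y 2) (x₁₃ := y 4) (x₂₃ := y 5) (z := z)
    (by linear_combination hz) h₁ h₂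
  refine ⟨a, b, c, h.trans ?_⟩
  ext i
  fin_cases i <;> rfl

theorem eq_zero_of_eval_mul_degenerate {u : MvPolynomial (Fin 6) ℂ}
    (hu : ∀ y, eval y degenerate ≠ 0 → eval y u = 0) : u = 0 := by
  have h : u * degenerate = 0 := by
    refine MvPolynomial.funext fun y => ?_
    rw [map_mul, map_zero]
    by_cases hy : eval y degenerate = 0
    · rw [hy, mul_zero]
    · rw [hu y hy, zero_mul]
  exact (mul_eq_zero.mp h).resolve_right degenerate_ne_zero

theorem dvd_of_Phi_eq_zero {p : MvPolynomial (Fin 7) ℂ} (hp : Phi p = 0) : K ∣ p := by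
  obtain ⟨u, v, r, rfl⟩ := exists_eq_linear_add_mul_K p
  have key : ∀ y, eval y degenerate ≠ 0 → ∀ z, z ^ 2 - eval y coeffK * z + eval y constK = 0 →
      eval y u + eval y v * z = 0 := by
    intro y hy z hz
    obtain ⟨a, b, c, h⟩ := exists_traceCoords_eq_snoc hy hz
    have h₀ := eval_traceCoords_eq_zero hp a b c
    have h₆ : (Fin.snoc (α := fun _ => ℂ) y z : Fin 7 → ℂ) 6 = z :=
      Fin.snoc_last (α := fun _ => ℂ) z y
    rwa [h, map_add, map_add, map_mul, map_mul, eval_snoc_K, hz, zero_mul, add_zero,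
      eval_castSucc, eval_castSucc, eval_X, h₆] at h₀
  have hv : v = 0 := by
    refine eq_zero_of_eval_mul_degenerate fun y hy => ?_
    obtain ⟨w, hw⟩ := IsAlgClosed.exists_pow_nat_eq (eval y coeffK ^ 2 - 4 * eval y constK) two_pos
    have h₁ := key y hy ((eval y coeffK + w) / 2) (by linear_combination hw / 4)
    have h₂ := key y hy ((eval y coeffK - w) / 2) (by linear_combination hw / 4)
    have hw₀ : w ≠ 0 := by
      rintro rfl
      apply hy
      rw [degenerate, map_mul, mul_eq_zero]
      right
      simp only [map_sub, map_mul, map_pow, map_ofNat]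
      linear_combination -hw
    refine (mul_eq_zero.mp ?_).resolve_right hw₀
    linear_combination h₁ - h₂
  have hu : u = 0 := by
    refine eq_zero_of_eval_mul_degenerate fun y hy => ?_
    obtain ⟨w, hw⟩ := IsAlgClosed.exists_pow_nat_eq (eval y coeffK ^ 2 - 4 * eval y constK) two_pos
    have h₁ := key y hy ((eval y coeffK + w) / 2) (by linear_combination hw / 4)
    simpa [hv] using h₁
  simp [hu, hv]

end Kernel

section Relations

theorem IsSkeinTrace.sub_eq {S : Type*} [CommRing S] {t : F3 → S} (ht : IsSkeinTrace t)
    (u v : F3) : t u - t v = (skeinTranslate t u ⟨t, ht.mem_skeinFun⟩).1 1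
      - (skeinTranslate t v ⟨t, ht.mem_skeinFun⟩).1 1 := by
  rw [← ht.eq_skeinTranslate, ← ht.eq_skeinTranslate]

theorem Phi_x1 : Phi x1 = cl ℂ g1 := aeval_X _ _
theorem Phi_x2 : Phi x2 = cl ℂ g2 := aeval_X _ _
theorem Phi_x3 : Phi x3 = cl ℂ g3 := aeval_X _ _
theorem Phi_x12 : Phi x12 = cl ℂ (g1 * g2) := aeval_X _ _
theorem Phi_x13 : Phi x13 = cl ℂ (g1 * g3) := aeval_X _ _
theorem Phi_x23 : Phi x23 = cl ℂ (g2 * g3) := aeval_X _ _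
theorem Phi_x123 : Phi x123 = cl ℂ (g1 * g2 * g3) := aeval_X _ _

theorem Phi_K : Phi K = 0 := by
  simp only [K, map_add, map_sub, map_mul, map_pow, map_ofNat, Phi_x1, Phi_x2, Phi_x3, Phi_x12,
    Phi_x13, Phi_x23, Phi_x123]
  exact (isSkeinTrace_cl ℂ F3).sq_g1_g2_g3

theorem Phi_Q_a1 : Phi Q_a1 = cl ℂ (ralpha * g1) - cl ℂ (rbeta * g1) := by
  rw [(isSkeinTrace_cl ℂ F3).sub_eq, ralpha, rbeta]
  simp only [map_mul, Module.End.mul_apply, skeinTranslate_g2_g1, skeinTranslate_g3_g1,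
    skeinTranslate_g3_g2, skeinTranslate_self, skeinTranslate_inv, map_add, map_sub, map_smul]
  simp only [Submodule.coe_add, Submodule.coe_sub, Submodule.coe_smul, Pi.add_apply, Pi.sub_apply,
    Pi.smul_apply, smul_eq_mul, skeinTranslate_apply, one_mul, (isSkeinTrace_cl ℂ F3).one, Q_a1,
    map_add, map_sub, map_neg, map_mul, map_pow, map_ofNat, Phi_x1, Phi_x2, Phi_x12,
    Phi_x13, Phi_x23, Phi_x123]
  ring

theorem Phi_Q_c1 : Phi Q_c1 = cl ℂ (rgamma * g1) - cl ℂ (rdelta * g1) := by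
  rw [(isSkeinTrace_cl ℂ F3).sub_eq, rgamma, rdelta]
  simp only [map_mul, Module.End.mul_apply, skeinTranslate_g2_g1, skeinTranslate_g3_g1,
    skeinTranslate_g3_g2, skeinTranslate_self, skeinTranslate_inv, map_add, map_sub, map_smul]
  simp only [Submodule.coe_add, Submodule.coe_sub, Submodule.coe_smul, Pi.add_apply, Pi.sub_apply,
    Pi.smul_apply, smul_eq_mul, skeinTranslate_apply, one_mul, (isSkeinTrace_cl ℂ F3).one, Q_c1,
    map_add, map_sub, map_mul, map_pow, map_ofNat, Phi_x1, Phi_x3, Phi_x12,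
    Phi_x13, Phi_x23, Phi_x123]
  ring

theorem Phi_Q_a2 : Phi Q_a2 = cl ℂ (ralpha * g2) - cl ℂ (rbeta * g2) := by
  rw [(isSkeinTrace_cl ℂ F3).sub_eq, ralpha, rbeta]
  simp only [map_mul, Module.End.mul_apply, skeinTranslate_g2_g1, skeinTranslate_g3_g1,
    skeinTranslate_g3_g2, skeinTranslate_self, skeinTranslate_inv, map_add, map_sub, map_smul]
  simp only [Submodule.coe_add, Submodule.coe_sub, Submodule.coe_smul, Pi.add_apply, Pi.sub_apply,
    Pi.smul_apply, smul_eq_mul, skeinTranslate_apply, one_mul, (isSkeinTrace_cl ℂ F3).one, Q_a2,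
    map_add, map_sub, map_neg, map_mul, map_pow, map_ofNat, Phi_x1, Phi_x2, Phi_x12,
    Phi_x13, Phi_x23, Phi_x123]
  ring

theorem Phi_Q_c3 : Phi Q_c3 = cl ℂ (rgamma * g3) - cl ℂ (rdelta * g3) := by
  rw [(isSkeinTrace_cl ℂ F3).sub_eq, rgamma, rdelta]
  simp only [map_mul, Module.End.mul_apply, skeinTranslate_g2_g1, skeinTranslate_g3_g1,
    skeinTranslate_g3_g2, skeinTranslate_self, skeinTranslate_inv, map_add, map_sub, map_smul]
  simp only [Submodule.coe_add, Submodule.coe_sub, Submodule.coe_smul, Pi.add_apply, Pi.sub_apply,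
    Pi.smul_apply, smul_eq_mul, skeinTranslate_apply, one_mul, (isSkeinTrace_cl ℂ F3).one, Q_c3,
    map_add, map_sub, map_mul, map_pow, map_ofNat, Phi_x1, Phi_x3, Phi_x12,
    Phi_x13, Phi_x23, Phi_x123]
  ring

theorem Phi_Q_a12 : Phi Q_a12 = cl ℂ (ralpha * (g1 * g2)) - cl ℂ (rbeta * (g1 * g2)) := by
  rw [(isSkeinTrace_cl ℂ F3).sub_eq, ralpha, rbeta]
  simp only [map_mul, Module.End.mul_apply, skeinTranslate_g2_g1, skeinTranslate_g3_g1,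
    skeinTranslate_g3_g2, skeinTranslate_self, skeinTranslate_inv, map_add, map_sub, map_smul]
  simp only [Submodule.coe_add, Submodule.coe_sub, Submodule.coe_smul, Pi.add_apply, Pi.sub_apply,
    Pi.smul_apply, smul_eq_mul, skeinTranslate_apply, one_mul, (isSkeinTrace_cl ℂ F3).one, Q_a12,
    map_add, map_sub, map_neg, map_mul, map_pow, map_ofNat, Phi_x1, Phi_x2, Phi_x12,
    Phi_x13, Phi_x23, Phi_x123]
  ring

theorem Phi_Q_c12 : Phi Q_c12 = cl ℂ (rgamma * (g1 * g2)) - cl ℂ (rdelta * (g1 * g2)) := by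
  rw [(isSkeinTrace_cl ℂ F3).sub_eq, rgamma, rdelta]
  simp only [map_mul, Module.End.mul_apply, skeinTranslate_g2_g1, skeinTranslate_g3_g1,
    skeinTranslate_g3_g2, skeinTranslate_self, skeinTranslate_inv, map_add, map_sub, map_smul]
  simp only [Submodule.coe_add, Submodule.coe_sub, Submodule.coe_smul, Pi.add_apply, Pi.sub_apply,
    Pi.smul_apply, smul_eq_mul, skeinTranslate_apply, one_mul, (isSkeinTrace_cl ℂ F3).one, Q_c12,
    map_add, map_sub, map_mul, map_pow, map_ofNat, Phi_x1, Phi_x2, Phi_x3, Phi_x12,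
    Phi_x13, Phi_x23, Phi_x123]
  ring

theorem Phi_Q_a13 : Phi Q_a13 = cl ℂ (ralpha * (g1 * g3)) - cl ℂ (rbeta * (g1 * g3)) := by
  rw [(isSkeinTrace_cl ℂ F3).sub_eq, ralpha, rbeta]
  simp only [map_mul, Module.End.mul_apply, skeinTranslate_g2_g1, skeinTranslate_g3_g1,
    skeinTranslate_g3_g2, skeinTranslate_self, skeinTranslate_inv, map_add, map_sub, map_smul]
  simp only [Submodule.coe_add, Submodule.coe_sub, Submodule.coe_smul, Pi.add_apply, Pi.sub_apply,
    Pi.smul_apply, smul_eq_mul, skeinTranslate_apply, one_mul, (isSkeinTrace_cl ℂ F3).one, Q_a13,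
    map_add, map_sub, map_neg, map_mul, map_pow, map_ofNat, Phi_x1, Phi_x2, Phi_x3, Phi_x12,
    Phi_x13, Phi_x23, Phi_x123]
  ring

theorem Phi_Q_c13 : Phi Q_c13 = cl ℂ (rgamma * (g1 * g3)) - cl ℂ (rdelta * (g1 * g3)) := by
  rw [(isSkeinTrace_cl ℂ F3).sub_eq, rgamma, rdelta]
  simp only [map_mul, Module.End.mul_apply, skeinTranslate_g2_g1, skeinTranslate_g3_g1,
    skeinTranslate_g3_g2, skeinTranslate_self, skeinTranslate_inv, map_add, map_sub, map_smul]
  simp only [Submodule.coe_add, Submodule.coe_sub, Submodule.coe_smul, Pi.add_apply, Pi.sub_apply,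
    Pi.smul_apply, smul_eq_mul, skeinTranslate_apply, one_mul, (isSkeinTrace_cl ℂ F3).one, Q_c13,
    map_add, map_sub, map_mul, map_pow, map_ofNat, Phi_x1, Phi_x3, Phi_x12,
    Phi_x13, Phi_x23, Phi_x123]
  ring

theorem Phi_Q_a23 : Phi Q_a23 = cl ℂ (ralpha * (g2 * g3)) - cl ℂ (rbeta * (g2 * g3)) := by
  rw [(isSkeinTrace_cl ℂ F3).sub_eq, ralpha, rbeta]
  simp only [map_mul, Module.End.mul_apply, skeinTranslate_g2_g1, skeinTranslate_g3_g1,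
    skeinTranslate_g3_g2, skeinTranslate_self, skeinTranslate_inv, map_add, map_sub, map_smul]
  simp only [Submodule.coe_add, Submodule.coe_sub, Submodule.coe_smul, Pi.add_apply, Pi.sub_apply,
    Pi.smul_apply, smul_eq_mul, skeinTranslate_apply, one_mul, (isSkeinTrace_cl ℂ F3).one, Q_a23,
    map_add, map_sub, map_mul, map_pow, map_ofNat, Phi_x1, Phi_x2, Phi_x3, Phi_x12,
    Phi_x13, Phi_x23, Phi_x123]
  ring

theorem Phi_Q_c23 : Phi Q_c23 = cl ℂ (rgamma * (g2 * g3)) - cl ℂ (rdelta * (g2 * g3)) := by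
  rw [(isSkeinTrace_cl ℂ F3).sub_eq, rgamma, rdelta]
  simp only [map_mul, Module.End.mul_apply, skeinTranslate_g2_g1, skeinTranslate_g3_g1,
    skeinTranslate_g3_g2, skeinTranslate_self, skeinTranslate_inv, map_add, map_sub, map_smul]
  simp only [Submodule.coe_add, Submodule.coe_sub, Submodule.coe_smul, Pi.add_apply, Pi.sub_apply,
    Pi.smul_apply, smul_eq_mul, skeinTranslate_apply, one_mul, (isSkeinTrace_cl ℂ F3).one, Q_c23,
    map_add, map_sub, map_neg, map_mul, map_pow, map_ofNat, Phi_x1, Phi_x2, Phi_x3, Phi_x12,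
    Phi_x13, Phi_x23, Phi_x123]
  ring

theorem Phi_Q_a123 :
    Phi Q_a123 = cl ℂ (ralpha * (g1 * g2 * g3)) - cl ℂ (rbeta * (g1 * g2 * g3)) := by
  rw [(isSkeinTrace_cl ℂ F3).sub_eq, ralpha, rbeta]
  simp only [map_mul, Module.End.mul_apply, skeinTranslate_g2_g1, skeinTranslate_g3_g1,
    skeinTranslate_g3_g2, skeinTranslate_self, skeinTranslate_inv, map_add, map_sub, map_smul]
  simp only [Submodule.coe_add, Submodule.coe_sub, Submodule.coe_smul, Pi.add_apply, Pi.sub_apply,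
    Pi.smul_apply, smul_eq_mul, skeinTranslate_apply, one_mul, (isSkeinTrace_cl ℂ F3).one, Q_a123,
    map_add, map_sub, map_neg, map_mul, map_pow, map_ofNat, Phi_x1, Phi_x2, Phi_x3, Phi_x12,
    Phi_x13, Phi_x23, Phi_x123]
  linear_combination (cl ℂ (g1 * g2) - cl ℂ g1 * cl ℂ g2) * (isSkeinTrace_cl ℂ F3).sq_g1_g2_g3

theorem Phi_Q_c123 :
    Phi Q_c123 = cl ℂ (rgamma * (g1 * g2 * g3)) - cl ℂ (rdelta * (g1 * g2 * g3)) := by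
  rw [(isSkeinTrace_cl ℂ F3).sub_eq, rgamma, rdelta]
  simp only [map_mul, Module.End.mul_apply, skeinTranslate_g2_g1, skeinTranslate_g3_g1,
    skeinTranslate_g3_g2, skeinTranslate_self, skeinTranslate_inv, map_add, map_sub, map_smul]
  simp only [Submodule.coe_add, Submodule.coe_sub, Submodule.coe_smul, Pi.add_apply, Pi.sub_apply,
    Pi.smul_apply, smul_eq_mul, skeinTranslate_apply, one_mul, (isSkeinTrace_cl ℂ F3).one, Q_c123,
    map_add, map_sub, map_neg, map_mul, map_pow, Phi_x1, Phi_x2, Phi_x3, Phi_x12,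
    Phi_x13, Phi_x23, Phi_x123]
  ring

end Relations

section Spanning

theorem forall_word {p : F3 → Prop} : (∀ i, p (word i)) ↔ p g1 ∧ p g2 ∧ p g3 ∧ p (g1 * g2) ∧
    p (g1 * g3) ∧ p (g2 * g3) ∧ p (g1 * g2 * g3) :=
  ⟨fun h => ⟨h 0, h 1, h 2, h 3, h 4, h 5, h 6⟩, fun ⟨h₀, h₁, h₂, h₃, h₄, h₅, h₆⟩ i => by
    fin_cases i <;> assumption⟩

variable {S : Type*} [CommRing S] {t : F3 → S}

/-- Skein-linear functions whose values at `1` and at the seven words lie in `P`. -/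
def ValuesIn (P : AddSubgroup S) (f : skeinFun t) : Prop :=
  f.1 1 ∈ P ∧ ∀ i, f.1 (word i) ∈ P

theorem valuesIn_skeinTranslate_of {P : AddSubgroup S} (hP : ∀ i, ∀ s ∈ P, t (word i) * s ∈ P)
    (k : Fin 3) {f : skeinFun t} (hf : ValuesIn P f) :
    ValuesIn P (skeinTranslate t (FreeGroup.of k) f) := by
  obtain ⟨h, hw⟩ := hf
  have hk : FreeGroup.of k = g1 ∨ FreeGroup.of k = g2 ∨ FreeGroup.of k = g3 := by
    fin_cases k
    exacts [Or.inl rfl, Or.inr (Or.inl rfl), Or.inr (Or.inr rfl)]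
  refine ⟨?_, (forall_word (p := fun w => (skeinTranslate t (FreeGroup.of k) f).1 w ∈ P)).mpr ?_⟩
  · fin_cases k
    exacts [hw 0, hw 1, hw 2]
  replace hw := (forall_word (p := fun w => f.1 w ∈ P)).mp hw
  have hc := (forall_word (p := fun w => ∀ s ∈ P, t w * s ∈ P)).mp hP
  have key (w : F3) : (skeinTranslate t (FreeGroup.of k) f).1 w =
      (skeinTranslate t w (skeinTranslate t (FreeGroup.of k) f)).1 1 := by
    simp [skeinTranslate_apply]
  rw [key g1, key g2, key g3, key (g1 * g2), key (g1 * g3), key (g2 * g3), key (g1 * g2 * g3)]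
  obtain ⟨h₁, h₂, h₃, h₁₂, h₁₃, h₂₃, h₁₂₃⟩ := hw
  obtain ⟨c₁, c₂, c₃, c₁₂, c₁₃, c₂₃, -⟩ := hc
  rcases hk with hk | hk | hk <;>
  simp only [hk, map_mul, Module.End.mul_apply, skeinTranslate_g2_g1, skeinTranslate_g3_g1,
    skeinTranslate_g3_g2, skeinTranslate_self, map_add, map_sub, map_smul] <;>
  simp only [Submodule.coe_add, Submodule.coe_sub, Submodule.coe_smul, Pi.add_apply, Pi.sub_apply,
    Pi.smul_apply, smul_eq_mul, skeinTranslate_apply, one_mul, sub_mul, mul_assoc, mul_add,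
    mul_sub] <;>
  simp only [mul_assoc] at h₁₂₃ <;>
  refine ⟨?_, ?_, ?_, ?_, ?_, ?_, ?_⟩ <;>
  repeat' first
    | assumption | apply sub_mem | apply add_mem | apply c₁ | apply c₂ | apply c₃ | apply c₁₂
    | apply c₁₃ | apply c₂₃

theorem mem_of_valuesIn {P : AddSubgroup S} (hP : ∀ i, ∀ s ∈ P, t (word i) * s ∈ P)
    {f : skeinFun t} (hf : ValuesIn P f) (g : F3) : f.1 g ∈ P := by
  suffices ∀ f : skeinFun t, ValuesIn P f → ValuesIn P (skeinTranslate t g f) by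
    simpa [skeinTranslate_apply] using (this f hf).1
  induction g using FreeGroup.induction_on with
  | C1 => simp
  | of k => exact fun f hf => valuesIn_skeinTranslate_of hP k hf
  | inv_of k ih =>
    intro f hf
    have hf' := ih f hf
    obtain ⟨i, hi⟩ : ∃ i, FreeGroup.of k = word i := by
      fin_cases k
      exacts [⟨0, rfl⟩, ⟨1, rfl⟩, ⟨2, rfl⟩]
    rw [skeinTranslate_inv]
    refine ⟨sub_mem ?_ hf'.1, fun j => sub_mem ?_ (hf'.2 j)⟩
    · rw [hi]
      exact hP i _ hf.1
    · rw [hi]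
      exact hP i _ (hf.2 j)
  | mul x y hx hy =>
    intro f hf
    rw [map_mul]
    exact hx _ (hy f hf)

end Spanning

section Presentation

open Subgroup

theorem Phi_surjective : Function.Surjective Phi := by
  refine surjective_of_cl_mem_range Phi fun g => ?_
  have hw (i : Fin 7) : cl ℂ (word i) ∈ Phi.range := ⟨X i, by simp [Phi]⟩
  refine mem_of_valuesIn (P := (Subalgebra.toSubmodule Phi.range).toAddSubgroup)
    (t := cl ℂ) (fun i s hs => Phi.range.mul_mem (hw i) hs)
    (f := ⟨cl ℂ, (isSkeinTrace_cl ℂ F3).mem_skeinFun⟩) ⟨?_, hw⟩ g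
  change cl ℂ (1 : F3) ∈ Phi.range
  rw [(isSkeinTrace_cl ℂ F3).one]
  exact ofNat_mem _ 2

theorem cl_mul_sub_cl_mul_mem {J : Ideal (SkeinAlgebra ℂ F3)} {u v : F3}
    (h : cl ℂ u - cl ℂ v ∈ J) (hw : ∀ i, cl ℂ (u * word i) - cl ℂ (v * word i) ∈ J) (g : F3) :
    cl ℂ (u * g) - cl ℂ (v * g) ∈ J := by
  have ht := (isSkeinTrace_cl ℂ F3).mem_skeinFun
  refine mem_of_valuesIn (P := J.toAddSubgroup) (t := cl ℂ) (fun i s hs => J.mul_mem_left _ hs)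
    (f := ⟨_, sub_mem (comp_mul_left_mem_skeinFun ht u) (comp_mul_left_mem_skeinFun ht v)⟩)
    ⟨?_, hw⟩ g
  change cl ℂ (u * 1) - cl ℂ (v * 1) ∈ J
  simpa using h

theorem Phi_mem_map {p : MvPolynomial (Fin 7) ℂ} (hp : p ∈ ({K, Q_a1, Q_c1, Q_a2, Q_c3, Q_a12,
    Q_c12, Q_a13, Q_c13, Q_a23, Q_c23, Q_a123, Q_c123} : Set (MvPolynomial (Fin 7) ℂ))) :
    Phi p ∈ IBorromean.map Phi :=
  Ideal.mem_map_of_mem Phi (Ideal.subset_span hp)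

theorem cl_ralpha_mul_sub_mem (g : F3) :
    cl ℂ (ralpha * g) - cl ℂ (rbeta * g) ∈ IBorromean.map Phi := by
  have ht := isSkeinTrace_cl ℂ F3
  refine cl_mul_sub_cl_mul_mem ?_ ((forall_word (p := fun w =>
    cl ℂ (ralpha * w) - cl ℂ (rbeta * w) ∈ IBorromean.map Phi)).mpr ⟨?_, ?_, ?_, ?_, ?_, ?_, ?_⟩) g
  · have h := ht.mul_comm g3 (g2⁻¹ * g1 * g2 * g1⁻¹)
    simp only [← mul_assoc] at h
    simp [ralpha, rbeta, h]
  · rw [← Phi_Q_a1]; exact Phi_mem_map (by simp)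
  · rw [← Phi_Q_a2]; exact Phi_mem_map (by simp)
  · have h := ht.mul_comm g3 (g2⁻¹ * g1 * g2 * g1⁻¹ * g3)
    simp only [← mul_assoc] at h
    simp [ralpha, rbeta, h]
  · rw [← Phi_Q_a12]; exact Phi_mem_map (by simp)
  · rw [← Phi_Q_a13]; exact Phi_mem_map (by simp)
  · rw [← Phi_Q_a23]; exact Phi_mem_map (by simp)
  · rw [← Phi_Q_a123]; exact Phi_mem_map (by simp)

theorem cl_rgamma_mul_sub_mem (g : F3) :
    cl ℂ (rgamma * g) - cl ℂ (rdelta * g) ∈ IBorromean.map Phi := by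
  have ht := isSkeinTrace_cl ℂ F3
  refine cl_mul_sub_cl_mul_mem ?_ ((forall_word (p := fun w =>
    cl ℂ (rgamma * w) - cl ℂ (rdelta * w) ∈ IBorromean.map Phi)).mpr ⟨?_, ?_, ?_, ?_, ?_, ?_, ?_⟩) g
  · have h := ht.mul_comm g2 (g1⁻¹ * g3 * g1 * g3⁻¹)
    simp only [← mul_assoc] at h
    simp [rgamma, rdelta, h]
  · rw [← Phi_Q_c1]; exact Phi_mem_map (by simp)
  · have h := ht.mul_comm g2 (g1⁻¹ * g3 * g1 * g3⁻¹ * g2)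
    simp only [← mul_assoc] at h
    simp [rgamma, rdelta, h]
  · rw [← Phi_Q_c3]; exact Phi_mem_map (by simp)
  · rw [← Phi_Q_c12]; exact Phi_mem_map (by simp)
  · rw [← Phi_Q_c13]; exact Phi_mem_map (by simp)
  · rw [← Phi_Q_c23]; exact Phi_mem_map (by simp)
  · rw [← Phi_Q_c123]; exact Phi_mem_map (by simp)

/-- The normal subgroup of elements whose insertion does not change a skein trace. -/
def IsSkeinTrace.kernel {G S : Type*} [Group G] [CommRing S] {t : G → S} (_ : IsSkeinTrace t) :
    Subgroup G where
  carrier := {u | ∀ g, t (u * g) = t g}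
  one_mem' := by simp
  mul_mem' {u v} hu hv g := by rw [mul_assoc, hu, hv]
  inv_mem' {u} hu g := by rw [← hu, mul_inv_cancel_left]

theorem IsSkeinTrace.normal_kernel {G S : Type*} [Group G] [CommRing S] {t : G → S}
    (ht : IsSkeinTrace t) : ht.kernel.Normal where
  conj_mem u hu k g := by
    rw [mul_assoc, mul_assoc, ht.mul_comm, mul_assoc, hu, ht.mul_comm, mul_inv_cancel_left]

theorem IsSkeinTrace.exists_quotient {G S : Type*} [Group G] [CommRing S] {t : G → S}
    (ht : IsSkeinTrace t) {N : Subgroup G} [N.Normal] (hN : N ≤ ht.kernel) :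
    ∃ s : G ⧸ N → S, IsSkeinTrace s ∧ ∀ g : G, s g = t g := by
  let s : G ⧸ N → S := Quotient.lift t fun a b hab => by
    have h := hN (QuotientGroup.leftRel_apply.mp hab) a
    rw [← h, ht.mul_comm, mul_inv_cancel_left]
  have hs (g : G) : s g = t g := rfl
  refine ⟨s, ⟨ht.one, fun g h => ?_⟩, hs⟩
  induction g using QuotientGroup.induction_on with
  | H g =>
    induction h using QuotientGroup.induction_on with
    | H h => exact ht.mul g h

theorem IsSkeinTrace.map {G S T : Type*} [Group G] [CommRing S] [CommRing T] {t : G → S}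
    (ht : IsSkeinTrace t) (φ : S →+* T) : IsSkeinTrace (φ ∘ t) where
  one := by rw [Function.comp_apply, ht.one, map_ofNat]
  mul g h := by simp [← map_mul, ht.mul]

theorem IsSkeinTrace.comp {G H S : Type*} [Group G] [Group H] [CommRing S] {t : H → S}
    (ht : IsSkeinTrace t) (φ : G →* H) : IsSkeinTrace (t ∘ φ) where
  one := by simp [ht.one]
  mul g h := by simp [ht.mul]

theorem exists_borromeanTrace : ∃ s : BorromeanGroup → SkeinAlgebra ℂ F3 ⧸ IBorromean.map Phi,
    IsSkeinTrace s ∧ ∀ g : F3, s g = Ideal.Quotient.mk (IBorromean.map Phi) (cl ℂ g) := by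
  have ht := (isSkeinTrace_cl ℂ F3).map (T := SkeinAlgebra ℂ F3 ⧸ IBorromean.map Phi)
    (Ideal.Quotient.mk (IBorromean.map Phi))
  have := ht.normal_kernel
  refine ht.exists_quotient (normalClosure_le_normal ?_)
  rintro u (rfl | rfl) g
  · simpa [mul_assoc] using Ideal.Quotient.eq.mpr (cl_ralpha_mul_sub_mem (rbeta⁻¹ * g))
  · simpa [mul_assoc] using Ideal.Quotient.eq.mpr (cl_rgamma_mul_sub_mem (rdelta⁻¹ * g))

/-- The map of skein algebras induced by a quotient map of groups. -/
def skeinProj (G : Type*) [Group G] (N : Subgroup G) [N.Normal] :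
    SkeinAlgebra ℂ G →ₐ[ℂ] SkeinAlgebra ℂ (G ⧸ N) :=
  skeinLift ℂ ((isSkeinTrace_cl ℂ (G ⧸ N)).comp (QuotientGroup.mk' N))

theorem skeinProj_cl {G : Type*} [Group G] (N : Subgroup G) [N.Normal] (g : G) :
    skeinProj G N (cl ℂ g) = cl ℂ (g : G ⧸ N) :=
  skeinLift_cl _ g

theorem skeinProj_surjective {G : Type*} [Group G] (N : Subgroup G) [N.Normal] :
    Function.Surjective (skeinProj G N) := by
  refine surjective_of_cl_mem_range _ fun g => ?_
  induction g using QuotientGroup.induction_on with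
  | H g => exact ⟨cl ℂ g, skeinProj_cl N g⟩

/-- `x_{i₁⋯i_k} ↦ [g_{i₁}⋯g_{i_k}]` in the skein algebra of the Borromean group. -/
def borromeanPhi : MvPolynomial (Fin 7) ℂ →ₐ[ℂ] SkeinAlgebra ℂ BorromeanGroup :=
  (skeinProj F3 _).comp Phi

theorem borromeanPhi_eq_zero {p : MvPolynomial (Fin 7) ℂ} {u v g : F3}
    (hp : Phi p = cl ℂ (u * g) - cl ℂ (v * g))
    (huv : u * v⁻¹ ∈ normalClosure {ralpha * rbeta⁻¹, rgamma * rdelta⁻¹}) :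
    borromeanPhi p = 0 := by
  have h : (u : BorromeanGroup) = v := by
    rw [QuotientGroup.eq_iff_div_mem, div_eq_mul_inv]
    exact huv
  rw [borromeanPhi, AlgHom.comp_apply, hp, map_sub, skeinProj_cl, skeinProj_cl,
    QuotientGroup.mk_mul, QuotientGroup.mk_mul, h, sub_self]

theorem borromeanPhi_K : borromeanPhi K = 0 := by
  rw [borromeanPhi, AlgHom.comp_apply, Phi_K, map_zero]

theorem IBorromean_le_ker : IBorromean ≤ RingHom.ker borromeanPhi := by
  have ha : ralpha * rbeta⁻¹ ∈ normalClosure {ralpha * rbeta⁻¹, rgamma * rdelta⁻¹} :=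
    subset_normalClosure (by simp)
  have hc : rgamma * rdelta⁻¹ ∈ normalClosure {ralpha * rbeta⁻¹, rgamma * rdelta⁻¹} :=
    subset_normalClosure (by simp)
  refine Ideal.span_le.mpr ?_
  rintro p (rfl | rfl | rfl | rfl | rfl | rfl | rfl | rfl | rfl | rfl | rfl | rfl | rfl)
  exacts [borromeanPhi_K, borromeanPhi_eq_zero Phi_Q_a1 ha, borromeanPhi_eq_zero Phi_Q_c1 hc,
    borromeanPhi_eq_zero Phi_Q_a2 ha, borromeanPhi_eq_zero Phi_Q_c3 hc,
    borromeanPhi_eq_zero Phi_Q_a12 ha, borromeanPhi_eq_zero Phi_Q_c12 hc,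
    borromeanPhi_eq_zero Phi_Q_a13 ha, borromeanPhi_eq_zero Phi_Q_c13 hc,
    borromeanPhi_eq_zero Phi_Q_a23 ha, borromeanPhi_eq_zero Phi_Q_c23 hc,
    borromeanPhi_eq_zero Phi_Q_a123 ha, borromeanPhi_eq_zero Phi_Q_c123 hc]

theorem ker_borromeanPhi_le : RingHom.ker borromeanPhi ≤ IBorromean := by
  obtain ⟨s, hs, hsF⟩ := exists_borromeanTrace
  have hcomp : (skeinLift ℂ hs).comp borromeanPhi =
      (Ideal.Quotient.mkₐ ℂ (IBorromean.map Phi)).comp Phi := by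
    ext i
    have hi : Phi (X i) = cl ℂ (word i) := by simp [Phi]
    simp only [borromeanPhi, AlgHom.comp_apply, hi, skeinProj_cl, skeinLift_cl, hsF]
    rfl
  intro p hp
  have hJ : Phi p ∈ IBorromean.map Phi := by
    have h := DFunLike.congr_fun hcomp p
    rw [AlgHom.comp_apply, RingHom.mem_ker.mp hp, map_zero] at h
    exact Ideal.Quotient.eq_zero_iff_mem.mp h.symm
  obtain ⟨q, hq, hqp⟩ := (Ideal.mem_map_iff_of_surjective Phi Phi_surjective).mp hJ
  have hK : K ∣ p - q := dvd_of_Phi_eq_zero (by rw [map_sub, hqp, sub_self])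
  have hKI : K ∈ IBorromean := Ideal.subset_span (Or.inl rfl)
  rw [← sub_add_cancel p q]
  exact add_mem (IBorromean.mem_of_dvd hK hKI) hq

theorem borromeanPhi_surjective : Function.Surjective borromeanPhi :=
  (skeinProj_surjective _).comp Phi_surjective

end Presentation

/-- Theorem 3: the skein algebra of the Borromean rings complement is
`ℂ[x₁,…,x₁₂₃]/I` with `I` generated by the fourteen explicit polynomials. -/
theorem skein_borromean :
    Nonempty (SkeinAlgebra ℂ BorromeanGroup ≃ₐ[ℂ]
      MvPolynomial (Fin 7) ℂ ⧸ IBorromean) := by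
  exact ⟨((Ideal.quotientEquivAlgOfEq ℂ (le_antisymm IBorromean_le_ker ker_borromeanPhi_le)).trans
    (Ideal.quotientKerAlgEquivOfSurjective borromeanPhi_surjective)).symm⟩
end
end
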